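/- Let $r > 0$ and $\varphi, \beta \in [0,\pi)$, and write $e(\alpha) = (\cos\alpha, \sin\alpha)$ for the unit vector of direction $\alpha$. Let $u$ be the closed segment $[-\tfrac{r}{2}e(\varphi), \tfrac{r}{2}e(\varphi)]$ of length $r$, direction $\varphi$, centred at the origin. Then the two-dimensional Lebesgue measure of the set of centres $$\Big\{ y \in \mathbb{R}^2 : \big[y - \tfrac{r}{2}e(\beta),\, y + \tfrac{r}{2}e(\beta)\big] \cap u \neq \emptyset \Big\}$$ equals $r^2 |\sin(\beta - \varphi)|$. -/

import Mathlib

open MeasureTheory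

/-- The unit vector `e(α) = (cos α, sin α)` in the Euclidean plane. -/
noncomputable def dirVec (α : ℝ) : EuclideanSpace ℝ (Fin 2) :=
  (WithLp.equiv 2 (Fin 2 → ℝ)).symm ![Real.cos α, Real.sin α]

theorem mem_segment_sub_add_iff {E : Type*} [AddCommGroup E] [Module ℝ E] {x y v : E} :
    x ∈ segment ℝ (y - v) (y + v) ↔ ∃ t ∈ Set.Icc (-1 : ℝ) 1, x = y + t • v := by
  rw [segment_eq_image']
  constructor
  · rintro ⟨θ, ⟨h0, h1⟩, rfl⟩
    exact ⟨2 * θ - 1, ⟨by linarith, by linarith⟩, by module⟩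
  · rintro ⟨t, ⟨h0, h1⟩, rfl⟩
    exact ⟨(t + 1) / 2, ⟨by linarith, by linarith⟩, by dsimp only; module⟩

/-- The translates of a segment that hit another segment form the Minkowski sum of the two. -/
theorem segment_inter_segment_nonempty_iff {E : Type*} [AddCommGroup E] [Module ℝ E] {y v w : E} :
    (segment ℝ (y - w) (y + w) ∩ segment ℝ (-v) v).Nonempty ↔
      ∃ s ∈ Set.Icc (-1 : ℝ) 1, ∃ t ∈ Set.Icc (-1 : ℝ) 1, y = s • v + t • w := by
  have hv (x : E) : x ∈ segment ℝ (-v) v ↔ ∃ s ∈ Set.Icc (-1 : ℝ) 1, x = s • v := by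
    simpa using mem_segment_sub_add_iff (x := x) (y := 0) (v := v)
  simp only [Set.Nonempty, Set.mem_inter_iff, mem_segment_sub_add_iff, hv]
  constructor
  · rintro ⟨x, ⟨t, ⟨h0, h1⟩, hx⟩, s, hs, rfl⟩
    exact ⟨s, hs, -t, ⟨by linarith, by linarith⟩, by rw [hx]; module⟩
  · rintro ⟨s, hs, t, ⟨h0, h1⟩, rfl⟩
    exact ⟨s • v, ⟨-t, ⟨by linarith, by linarith⟩, by module⟩, s, hs, rfl⟩

theorem volume_setOf_segment_inter_segment_nonempty (v w : EuclideanSpace ℝ (Fin 2)) :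
    volume {y | (segment ℝ (y - w) (y + w) ∩ segment ℝ (-v) v).Nonempty} =
      ENNReal.ofReal (4 * |v 0 * w 1 - w 0 * v 1|) := by
  have himage : WithLp.toLp 2 ⁻¹' {y | (segment ℝ (y - w) (y + w) ∩ segment ℝ (-v) v).Nonempty} =
      Matrix.toLin' !![v 0, w 0; v 1, w 1] '' Set.Icc (fun _ ↦ -1) (fun _ ↦ 1) := by
    ext y
    simp only [Set.mem_preimage, Set.mem_ofPred_eq, segment_inter_segment_nonempty_iff,
      Set.mem_image]
    constructor
    · rintro ⟨s, hs, t, ht, h⟩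
      refine ⟨![s, t], ?_, ?_⟩
      · constructor <;> intro i <;> fin_cases i <;> simp [hs.1, hs.2, ht.1, ht.2]
      · ext i
        have := congrArg (fun z ↦ z i) h
        fin_cases i <;> simp_all [Matrix.mulVec, dotProduct, mul_comm]
    · rintro ⟨x, hx, rfl⟩
      refine ⟨x 0, ⟨hx.1 0, hx.2 0⟩, x 1, ⟨hx.1 1, hx.2 1⟩, ?_⟩
      ext i
      fin_cases i <;> simp [Matrix.mulVec, dotProduct, mul_comm]
  rw [← (PiLp.volume_preserving_toLp (Fin 2)).measure_preimage_equiv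
      (f := MeasurableEquiv.toLp 2 (Fin 2 → ℝ)),
    MeasurableEquiv.coe_toLp, himage, Measure.addHaar_image_linearMap, LinearMap.det_toLin',
    Matrix.det_fin_two_of, Real.volume_Icc_pi, Fin.prod_univ_two,
    ← ENNReal.ofReal_mul (by norm_num), ← ENNReal.ofReal_mul (abs_nonneg _)]
  congr 1
  ring

/-- area of the hitting set, Section 4 of the paper.
For `r > 0` and directions `φ, β ∈ [0,π)`, let `u` be the segment
`[-(r/2)e(φ), (r/2)e(φ)]` of length `r` and direction `φ` centred at the origin.
Then the Lebesgue measure of the set of centres `y` such that the segment of length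
`r` and direction `β` centred at `y` hits `u` equals `r² |sin(β - φ)|`. -/
theorem stmt5 (r : ℝ) (hr : 0 < r) (φ β : ℝ)
    (hφ : φ ∈ Set.Ico (0 : ℝ) Real.pi) (hβ : β ∈ Set.Ico (0 : ℝ) Real.pi) :
    volume {y : EuclideanSpace ℝ (Fin 2) |
        (segment ℝ (y - (r / 2) • dirVec β) (y + (r / 2) • dirVec β) ∩
          segment ℝ (-((r / 2) • dirVec φ)) ((r / 2) • dirVec φ)).Nonempty}
      = ENNReal.ofReal (r ^ 2 * |Real.sin (β - φ)|) := by
  rw [volume_setOf_segment_inter_segment_nonempty]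
  have h : (r / 2 * Real.cos φ) * (r / 2 * Real.sin β) - (r / 2 * Real.cos β) * (r / 2 * Real.sin φ)
      = (r / 2) ^ 2 * Real.sin (β - φ) := by
    rw [Real.sin_sub]
    ring
  simp only [dirVec, PiLp.smul_apply, WithLp.equiv_symm_apply_ofLp, Matrix.cons_val_zero,
    Matrix.cons_val_one, smul_eq_mul]
  rw [h, abs_mul, abs_of_nonneg (sq_nonneg _)]
  congr 1
  ring
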